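/- Let (Ω, 𝓕, ℙ) be a probability space, X : Ω → 𝓧 a measurable map into a measurable space, W : Ω → ℝ a random variable taking values in {0,1}, and Y₀, Y₁ : Ω → ℝ integrable random variables. Let e(X) be a version of the conditional expectation E[W | σ(X)] and suppose there exists ε > 0 with ε ≤ e(X) ≤ 1 − ε almost surely. Assume unconfoundedness: the pair (Y₀, Y₁) is conditionally independent of W given σ(X). Define Y^obs = W·Y₁ + (1−W)·Y₀ and the Athey–Imbens transformed outcome Z* = Y^obs·(W − e(X)) / (e(X)·(1 − e(X))). Then, almost surely, E[Z* | σ(X)] = E[Y₁ | σ(X)] − E[Y₀ | σ(X)]. -/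

import Mathlib

open MeasureTheory ProbabilityTheory

/-- Conditional independence factorises the conditional expectation of a product. -/
theorem condExp_mul_of_condIndepFun_aux
    {Ω : Type*} {m mΩ : MeasurableSpace Ω} [StandardBorelSpace Ω]
    (μ : Measure Ω) [IsFiniteMeasure μ] (hm : m ≤ mΩ) (Y W : Ω → ℝ)
    (hW : Measurable W) (hY : Integrable Y μ) (hWi : Integrable W μ)
    (hYW : Integrable (fun ω => Y ω * W ω) μ)
    (h : CondIndepFun m hm Y W μ) :
    μ[fun ω => Y ω * W ω | m] =ᵐ[μ] fun ω => (μ[Y | m]) ω * (μ[W | m]) ω := by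
  have hY' := aestronglyMeasurable_trim_condExpKernel hm hY.1
  set Y' := hY.1.mk Y with hY'def
  have hYm : Measurable Y' := hY.1.stronglyMeasurable_mk.measurable
  have h' : CondIndepFun m hm Y' W μ :=
    Kernel.IndepFun.congr' h hY' (Filter.Eventually.of_forall fun _ => Filter.EventuallyEq.rfl)
  rw [condIndepFun_iff_map_prod_eq_prod_map_map hYm hW] at h'
  filter_upwards [ae_of_ae_trim hm h', ae_of_ae_trim hm hY',
    condExp_ae_eq_integral_condExpKernel hm hY, condExp_ae_eq_integral_condExpKernel hm hWi,
    condExp_ae_eq_integral_condExpKernel hm hYW] with ω h1 h2 h3 h4 h5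
  rw [h3, h4, h5]
  have hind : IndepFun Y' W (condExpKernel μ m ω) := by
    rw [indepFun_iff_map_prod_eq_prod_map_map hYm.aemeasurable hW.aemeasurable]
    rw [Kernel.map_apply _ (hYm.prodMk hW), Kernel.prod_apply, Kernel.map_apply _ hYm,
      Kernel.map_apply _ hW] at h1
    exact h1
  have hind2 : IndepFun Y W (condExpKernel μ m ω) := hind.congr h2.symm Filter.EventuallyEq.rfl
  exact hind2.integral_fun_mul_eq_mul_integral
    (hYm.aestronglyMeasurable.congr h2.symm) hW.aestronglyMeasurable

/-- Conditional unbiasedness of the Athey–Imbens transformed outcome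
`Z* = Y^obs·(W − e(X)) / (e(X)·(1 − e(X)))` for the CATE. -/
theorem transformed_outcome_condExp
    {Ω 𝓧 : Type*} [MeasureSpace Ω] [IsProbabilityMeasure (ℙ : Measure Ω)]
    [StandardBorelSpace Ω]
    [m𝓧 : MeasurableSpace 𝓧]
    (X : Ω → 𝓧) (hX : Measurable X)
    (W Y₀ Y₁ : Ω → ℝ)
    (hW : Measurable W) (hWbin : ∀ ω, W ω = 0 ∨ W ω = 1)
    (hY₀ : Integrable Y₀ ℙ) (hY₁ : Integrable Y₁ ℙ)
    (e : Ω → ℝ) (he : e =ᵐ[ℙ] ℙ[W | m𝓧.comap X])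
    (ε : ℝ) (hε : 0 < ε)
    (hbound : ∀ᵐ ω ∂ℙ, ε ≤ e ω ∧ e ω ≤ 1 - ε)
    (hunconf : CondIndepFun (m𝓧.comap X) hX.comap_le (fun ω => (Y₀ ω, Y₁ ω)) W ℙ) :
    ℙ[(fun ω => (W ω * Y₁ ω + (1 - W ω) * Y₀ ω) * (W ω - e ω) /
        (e ω * (1 - e ω))) | m𝓧.comap X]
      =ᵐ[ℙ] fun ω => (ℙ[Y₁ | m𝓧.comap X]) ω - (ℙ[Y₀ | m𝓧.comap X]) ω := by
  have hm := hX.comap_le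
  have hWb : ∀ᵐ ω ∂(ℙ : Measure Ω), ‖W ω‖ ≤ 1 := by
    refine Filter.Eventually.of_forall fun ω => ?_
    rcases hWbin ω with h | h <;> simp [h]
  have hWi : Integrable W (ℙ : Measure Ω) :=
    Integrable.of_bound hW.aestronglyMeasurable 1 hWb
  have hYW0 : Integrable (fun ω => Y₀ ω * W ω) (ℙ : Measure Ω) :=
    hY₀.mul_bdd hW.aestronglyMeasurable hWb
  have hYW1 : Integrable (fun ω => Y₁ ω * W ω) (ℙ : Measure Ω) :=
    hY₁.mul_bdd hW.aestronglyMeasurable hWb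
  have c0 := condExp_mul_of_condIndepFun_aux ℙ hm Y₀ W hW hY₀ hWi hYW0
    (hunconf.comp measurable_fst measurable_id)
  have c1 := condExp_mul_of_condIndepFun_aux ℙ hm Y₁ W hW hY₁ hWi hYW1
    (hunconf.comp measurable_snd measurable_id)
  set p := ℙ[W | m𝓧.comap X] with hp
  have hpm : StronglyMeasurable[m𝓧.comap X] p := stronglyMeasurable_condExp
  have hb : ∀ᵐ ω ∂(ℙ : Measure Ω), ε ≤ p ω ∧ p ω ≤ 1 - ε := by
    filter_upwards [he, hbound] with ω h1 h2
    rwa [h1] at h2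
  have g1m : StronglyMeasurable[m𝓧.comap X] (fun ω => (p ω)⁻¹) := hpm.measurable.inv.stronglyMeasurable
  have g0m : StronglyMeasurable[m𝓧.comap X] (fun ω => (1 - p ω)⁻¹) :=
    (hpm.measurable.const_sub 1).inv.stronglyMeasurable
  have g1b : ∀ᵐ ω ∂(ℙ : Measure Ω), ‖(p ω)⁻¹‖ ≤ ε⁻¹ := by
    filter_upwards [hb] with ω h
    rw [norm_inv, Real.norm_of_nonneg (by linarith)]
    exact inv_anti₀ hε h.1
  have g0b : ∀ᵐ ω ∂(ℙ : Measure Ω), ‖(1 - p ω)⁻¹‖ ≤ ε⁻¹ := by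
    filter_upwards [hb] with ω h
    rw [norm_inv, Real.norm_of_nonneg (by linarith)]
    exact inv_anti₀ hε (by linarith)
  have i1 : Integrable ((fun ω => Y₁ ω * W ω) * fun ω => (p ω)⁻¹) (ℙ : Measure Ω) :=
    hYW1.mul_bdd (g1m.mono hm).aestronglyMeasurable g1b
  have i0 : Integrable ((Y₀ - fun ω => Y₀ ω * W ω) * fun ω => (1 - p ω)⁻¹) (ℙ : Measure Ω) :=
    (hY₀.sub hYW0).mul_bdd (g0m.mono hm).aestronglyMeasurable g0b
  have d1 := condExp_mul_of_stronglyMeasurable_right g1m i1 hYW1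
  have d0 := condExp_mul_of_stronglyMeasurable_right g0m i0 (hY₀.sub hYW0)
  have s0 := condExp_sub hY₀ hYW0 (m𝓧.comap X)
  have s := condExp_sub i1 i0 (m𝓧.comap X)
  have key : (fun ω => (W ω * Y₁ ω + (1 - W ω) * Y₀ ω) * (W ω - e ω) /
        (e ω * (1 - e ω))) =ᵐ[ℙ] ((fun ω => Y₁ ω * W ω) * fun ω => (p ω)⁻¹) -
        ((Y₀ - fun ω => Y₀ ω * W ω) * fun ω => (1 - p ω)⁻¹) := by
    filter_upwards [he, hb] with ω h1 h2
    have : p ω ≠ 0 := by linarith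
    have : 1 - p ω ≠ 0 := by linarith
    simp only [Pi.sub_apply, Pi.mul_apply, h1]
    rcases hWbin ω with h | h <;> rw [h] <;> field_simp <;> ring
  filter_upwards [condExp_congr_ae (m := m𝓧.comap X) key, s, s0, d0, d1, c0, c1, hb]
    with ω h1 h2 h3 h4 h5 h6 h7 h8
  have n1 : p ω ≠ 0 := by linarith
  have n0 : 1 - p ω ≠ 0 := by linarith
  rw [h1, h2, Pi.sub_apply, h4, h5, Pi.mul_apply, Pi.mul_apply, h3, Pi.sub_apply, h6, h7]
  field_simp
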